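/- arXiv:2109.00655 — 3 statements merged into one kernel-verified Lean document; each statement's English description precedes it below -/
import Mathlib

section
/- Antipodal relation for hypercubes. Let d ≥ 1 and let x be a (d+1)-cube ball packing in ℝ^{d+2}. Then the sum κ(x_u) + κ(x_ū) is the same for all vertices u ∈ {0,1}^{d+1}, where ū denotes the bitwise complement of u (the vertex antipodal to u, at maximal distance in the 1-skeleton of the cube). -/
noncomputable section

open Finset

/-- Inversive product on ℝ^{d+2}. -/
def Qd (d : ℕ) (a b : Fin (d + 2) → ℝ) : ℝ :=
  (∑ i : Fin (d + 1), a i.castSucc * b i.castSucc) -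
    a (Fin.last (d + 1)) * b (Fin.last (d + 1))

/-- Curvature of a d-ball in inversive coordinates. -/
def curvd (d : ℕ) (a : Fin (d + 2) → ℝ) : ℝ :=
  a (Fin.last (d + 1)) - a ((Fin.last d).castSucc)

/-- A (d+1)-cube ball packing, indexed by the vertices `{0,1}^{d+1}` of the (d+1)-cube
(here `Fin (d+1) → Bool`), with inversive products prescribed by Hamming distance. -/
def IsCubePacking (d : ℕ) (x : (Fin (d + 1) → Bool) → (Fin (d + 2) → ℝ)) : Prop :=
  ∀ u v, Qd d (x u) (x v) = 1 - 2 * (hammingDist u v : ℝ)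

/-- The inversive product as a bilinear form. -/
def inversiveForm (d : ℕ) : LinearMap.BilinForm ℝ (Fin (d + 2) → ℝ) :=
  LinearMap.mk₂ ℝ (Qd d)
    (fun a b c => by simp only [Qd, Pi.add_apply, add_mul, sum_add_distrib]; ring)
    (fun r a b => by
      simp only [Qd, Pi.smul_apply, smul_eq_mul, mul_assoc, ← mul_sum]; ring)
    (fun a b c => by simp only [Qd, Pi.add_apply, mul_add, sum_add_distrib]; ring)
    (fun r a b => by
      simp only [Qd, Pi.smul_apply, smul_eq_mul, mul_left_comm _ r, ← mul_sum]; ring)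

theorem inversiveForm_apply (d : ℕ) (a b : Fin (d + 2) → ℝ) :
    inversiveForm d a b = Qd d a b := rfl

/-- The curvature is, up to sign, the inversive product with a fixed isotropic vector. -/
theorem exists_inversiveForm_eq_neg_curvd (d : ℕ) :
    ∃ c : Fin (d + 2) → ℝ, ∀ a, inversiveForm d a c = -curvd d a := by
  refine ⟨fun i => if i = Fin.last (d + 1) ∨ i = (Fin.last d).castSucc then 1 else 0,
    fun a => ?_⟩
  simp [inversiveForm_apply, Qd, curvd, Fin.castSucc_ne_last]

theorem hammingDist_add_hammingDist_not {ι : Type*} [Fintype ι] (u v : ι → Bool) :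
    hammingDist u v + hammingDist (fun i => !u i) v = Fintype.card ι := by
  classical
  have h := card_filter_add_card_filter_not (s := (univ : Finset ι)) (fun i => u i ≠ v i)
  rw [card_univ] at h
  rw [← h, hammingDist, hammingDist]
  congr 2
  ext i
  cases hu : u i <;> cases hv : v i <;> simp [hu, hv]

theorem hammingDist_false_decide_eq {ι : Type*} [Fintype ι] [DecidableEq ι] (i : ι) :
    hammingDist (fun _ : ι => false) (fun k => decide (k = i)) = 1 := by
  simp [hammingDist, filter_eq']

theorem hammingDist_decide_eq_decide_eq {ι : Type*} [Fintype ι] [DecidableEq ι] {i j : ι}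
    (h : i ≠ j) :
    hammingDist (fun k : ι => decide (k = i)) (fun k => decide (k = j)) = 2 := by
  rw [hammingDist, ← card_pair h]
  congr 1
  ext k
  by_cases hi : k = i <;> by_cases hj : k = j <;> simp_all

namespace IsCubePacking

variable {d : ℕ} {x : (Fin (d + 1) → Bool) → (Fin (d + 2) → ℝ)}

theorem inversiveForm_eq (hx : IsCubePacking d x) (u v : Fin (d + 1) → Bool) :
    inversiveForm d (x u) (x v) = 1 - 2 * (hammingDist u v : ℝ) := hx u v

/-- The sum of two antipodal vectors has the same product with every vector of the packing. -/
theorem inversiveForm_antipodal_sum (hx : IsCubePacking d x) (u v : Fin (d + 1) → Bool) :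
    inversiveForm d (x u + x fun i => !u i) (x v) = -2 * d := by
  have h : ((hammingDist u v + hammingDist (fun i => !u i) v : ℕ) : ℝ) = (d + 1 : ℕ) := by
    rw [hammingDist_add_hammingDist_not, Fintype.card_fin]
  push_cast at h
  rw [map_add, LinearMap.add_apply, hx.inversiveForm_eq, hx.inversiveForm_eq]
  linarith

/-- The sum of an antipodal pair together with the differences along the edges at one vertex.
In a cube packing this is an orthogonal basis. -/
def frame (x : (Fin (d + 1) → Bool) → (Fin (d + 2) → ℝ)) :
    Option (Fin (d + 1)) → (Fin (d + 2) → ℝ)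
  | none => x (fun _ => false) + x fun _ => !false
  | some i => x (fun k => decide (k = i)) - x fun _ => false

theorem inversiveForm_frame_none_some (hx : IsCubePacking d x) (i : Fin (d + 1)) :
    inversiveForm d (frame x none) (frame x (some i)) = 0 := by
  rw [frame, frame, map_sub, hx.inversiveForm_antipodal_sum, hx.inversiveForm_antipodal_sum,
    sub_self]

theorem inversiveForm_frame_none_none (hx : IsCubePacking d x) :
    inversiveForm d (frame x none) (frame x none) = -4 * d := by
  rw [frame, map_add, hx.inversiveForm_antipodal_sum, hx.inversiveForm_antipodal_sum]
  ring

theorem inversiveForm_frame_some_some (hx : IsCubePacking d x) (i j : Fin (d + 1)) :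
    inversiveForm d (frame x (some i)) (frame x (some j)) = if i = j then 4 else 0 := by
  simp only [frame, map_sub, LinearMap.sub_apply, hx.inversiveForm_eq]
  rw [hammingDist_comm _ fun _ => false]
  split_ifs with h
  · subst h
    rw [hammingDist_false_decide_eq, hammingDist_self, hammingDist_self]
    norm_num
  · rw [hammingDist_false_decide_eq, hammingDist_false_decide_eq,
      hammingDist_decide_eq_decide_eq h, hammingDist_self]
    norm_num

theorem inversiveForm_comm (a b : Fin (d + 2) → ℝ) :
    inversiveForm d a b = inversiveForm d b a := by
  simp only [inversiveForm_apply, Qd, mul_comm]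

theorem span_frame (hd : 1 ≤ d) (hx : IsCubePacking d x) :
    Submodule.span ℝ (Set.range (frame x)) = ⊤ := by
  have hli : LinearIndependent ℝ (frame x) := by
    refine LinearMap.linearIndependent_of_isOrthoᵢ (B := inversiveForm d) ?_ ?_
    · rintro (_ | i) (_ | j) hij
      · exact absurd rfl hij
      · exact hx.inversiveForm_frame_none_some j
      · exact (inversiveForm_comm _ _).trans (hx.inversiveForm_frame_none_some i)
      · exact (hx.inversiveForm_frame_some_some i j).trans
          (if_neg fun h => hij (congrArg some h))
    · rintro (_ | i) h
      · have h' := hx.inversiveForm_frame_none_none.symm.trans h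
        have : (1 : ℝ) ≤ d := by exact_mod_cast hd
        linarith
      · have h' := (hx.inversiveForm_frame_some_some i i).symm.trans h
        norm_num at h'
  exact hli.span_eq_top_of_card_eq_finrank' (by simp)

end IsCubePacking

/-- Antipodal relation for hypercubes: the sum of the curvatures of a ball and its antipodal
ball (at the bitwise-complement vertex) does not depend on the vertex. -/
theorem hypercube_antipodal (d : ℕ) (hd : 1 ≤ d)
    (x : (Fin (d + 1) → Bool) → (Fin (d + 2) → ℝ)) (hx : IsCubePacking d x)
    (u v : Fin (d + 1) → Bool) :
    curvd d (x u) + curvd d (x fun i => !u i) =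
      curvd d (x v) + curvd d (x fun i => !v i) := by
  obtain ⟨c, hc⟩ := exists_inversiveForm_eq_neg_curvd d
  have hker : inversiveForm d (x u + x fun i => !u i) =
      inversiveForm d (x v + x fun i => !v i) := by
    refine LinearMap.ext_on_range (hx.span_frame hd) ?_
    rintro (_ | i) <;>
      simp only [IsCubePacking.frame, map_add (inversiveForm d (_ + _)),
        map_sub (inversiveForm d (_ + _)), hx.inversiveForm_antipodal_sum]
  have h := LinearMap.congr_fun hker c
  simp only [map_add, LinearMap.add_apply, hc] at h
  linarith
end
end

section
/- Orthoplicial sphere packings are polytopal (Gram rigidity). Let x be a family indexed by i ∈ {±1,±2,±3,±4} of vectors of ℝ⁵ such that Q₃(xᵢ,xᵢ) = 1 for all i, Q₃(xᵢ,xⱼ) = −1 whenever j ∉ {i,−i}, and Q₃(xᵢ,x₋ᵢ) < −1 for all i (a sphere packing whose tangency graph is the 1-skeleton of the 4-dimensional orthoplex, with the four antipodal pairs of spheres disjoint). Then Q₃(xᵢ,x₋ᵢ) = −3 for all i. -/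
noncomputable section

/-- Inversive product on ℝ⁵. -/
def Q3 (a b : Fin 5 → ℝ) : ℝ := a 0 * b 0 + a 1 * b 1 + a 2 * b 2 + a 3 * b 3 - a 4 * b 4

lemma Q3_comm (a b : Fin 5 → ℝ) : Q3 a b = Q3 b a := by
  simp only [Q3]; ring

lemma Q3_add_right (a b c : Fin 5 → ℝ) : Q3 a (b + c) = Q3 a b + Q3 a c := by
  simp only [Q3, Pi.add_apply]; ring

lemma Q3_sub_right (a b c : Fin 5 → ℝ) : Q3 a (b - c) = Q3 a b - Q3 a c := by
  simp only [Q3, Pi.sub_apply]; ring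

lemma Q3_smul_right (r : ℝ) (a b : Fin 5 → ℝ) : Q3 a (r • b) = r * Q3 a b := by
  simp only [Q3, Pi.smul_apply, smul_eq_mul]; ring

lemma Q3_add_left (a b c : Fin 5 → ℝ) : Q3 (a + b) c = Q3 a c + Q3 b c := by
  simp only [Q3, Pi.add_apply]; ring

lemma Q3_sub_left (a b c : Fin 5 → ℝ) : Q3 (a - b) c = Q3 a c - Q3 b c := by
  simp only [Q3, Pi.sub_apply]; ring

lemma Q3_zero_right (a : Fin 5 → ℝ) : Q3 a 0 = 0 := by
  simp [Q3]

lemma Q3_sum_smul_right {ι : Type*} (s : Finset ι) (g : ι → ℝ) (v : ι → Fin 5 → ℝ)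
    (a : Fin 5 → ℝ) : Q3 a (∑ k ∈ s, g k • v k) = ∑ k ∈ s, g k * Q3 a (v k) := by
  classical
  induction s using Finset.induction_on with
  | empty => simp [Q3_zero_right]
  | insert k s hk ih =>
    rw [Finset.sum_insert hk, Finset.sum_insert hk, Q3_add_right, Q3_smul_right, ih]

/-- Two vectors of ℝ⁵ that are orthogonal to four pairwise orthogonal non-isotropic vectors are
proportional, so their Gram determinant vanishes. -/
lemma Q3_gram_det_eq_zero (d : Fin 4 → Fin 5 → ℝ) (u v : Fin 5 → ℝ)
    (hdd : ∀ i, Q3 (d i) (d i) ≠ 0) (hd : ∀ i j, i ≠ j → Q3 (d i) (d j) = 0)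
    (hu : ∀ i, Q3 (d i) u = 0) (hv : ∀ i, Q3 (d i) v = 0) :
    Q3 u u * Q3 v v = Q3 u v ^ 2 := by
  have hdep : ¬ LinearIndependent ℝ (Sum.elim d ![u, v]) := fun h => by
    have := h.fintype_card_le_finrank
    simp at this
  obtain ⟨g, hg, k, hk⟩ := Fintype.not_linearIndependent_iff.1 hdep
  have hpair (a : Fin 5 → ℝ) :
      ∑ i, g (.inl i) * Q3 a (d i) + (g (.inr 0) * Q3 a u + g (.inr 1) * Q3 a v) = 0 := by
    have := congrArg (Q3 a) hg
    rw [Q3_sum_smul_right, Q3_zero_right] at this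
    simpa [Fintype.sum_sum_type] using this
  have hl (i : Fin 4) : g (.inl i) = 0 := by
    have := hpair (d i)
    rw [hu, hv, Finset.sum_eq_single i (fun j _ hj => by rw [hd i j hj.symm, mul_zero])
      (by simp)] at this
    simpa [hdd i] using this
  have hU := hpair u
  have hV := hpair v
  simp only [hl, zero_mul, Finset.sum_const_zero, zero_add] at hU hV
  rw [Q3_comm v u] at hV
  have h0 : g (.inr 0) * (Q3 u u * Q3 v v - Q3 u v ^ 2) = 0 := by
    linear_combination Q3 v v * hU - Q3 u v * hV
  have h1 : g (.inr 1) * (Q3 u u * Q3 v v - Q3 u v ^ 2) = 0 := by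
    linear_combination Q3 u u * hV - Q3 u v * hU
  rw [← sub_eq_zero]
  rcases k with i | k
  · exact absurd (hl i) hk
  · fin_cases k
    · exact (mul_eq_zero.1 h0).resolve_left hk
    · exact (mul_eq_zero.1 h1).resolve_left hk

/-- Gram rigidity of orthoplicial sphere packings: in any sphere packing whose tangency graph
is the 1-skeleton of the 4-orthoplex (indexed by `Fin 4 × Bool`, negation flipping the
boolean), the inversive product of each pair of disjoint (antipodal) spheres equals −3. -/
theorem orthoplicial_gram_rigidity (x : Fin 4 × Bool → (Fin 5 → ℝ))
    (hnorm : ∀ k, Q3 (x k) (x k) = 1)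
    (htan : ∀ k l, l ≠ k → l ≠ (k.1, !k.2) → Q3 (x k) (x l) = -1)
    (hdisj : ∀ k, Q3 (x k) (x (k.1, !k.2)) < -1) :
    ∀ k, Q3 (x k) (x (k.1, !k.2)) = -3 := by
  have hflip (i : Fin 4) : Q3 (x (i, false)) (x (i, true)) = Q3 (x (i, true)) (x (i, false)) :=
    Q3_comm _ _
  have hlt (i : Fin 4) : Q3 (x (i, true)) (x (i, false)) < -1 := hdisj (i, true)
  have htan' (i j : Fin 4) (hij : i ≠ j) (a b : Bool) : Q3 (x (i, a)) (x (j, b)) = -1 :=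
    htan _ _ (fun h => hij (congrArg Prod.fst h).symm) (fun h => hij (congrArg Prod.fst h).symm)
  have hprod (i j : Fin 4) (hij : i ≠ j) : (1 + Q3 (x (i, true)) (x (i, false))) *
      (1 + Q3 (x (j, true)) (x (j, false))) = 4 := by
    have hds (l m : Fin 4) :
        Q3 (x (l, true) - x (l, false)) (x (m, true) + x (m, false)) = 0 := by
      rw [Q3_sub_left, Q3_add_right, Q3_add_right]
      rcases eq_or_ne l m with rfl | h
      · rw [hnorm, hnorm, hflip]; ring
      · simp only [htan' l m h]; ring
    have key := Q3_gram_det_eq_zero (fun l => x (l, true) - x (l, false))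
      (x (i, true) + x (i, false)) (x (j, true) + x (j, false))
      (fun l => by
        have := hlt l
        simp only [Q3_sub_left, Q3_sub_right, hnorm, hflip]
        linarith)
      (fun l m h => by
        simp only [Q3_sub_left, Q3_sub_right, htan' l m h]; ring)
      (fun l => hds l i) (fun l => hds l j)
    simp only [Q3_add_left, Q3_add_right, hnorm, hflip, htan' i j hij] at key
    linear_combination key / 4
  have hval (i j l : Fin 4) (hij : i ≠ j) (hil : i ≠ l) (hjl : j ≠ l) :
      Q3 (x (i, true)) (x (i, false)) = -3 := by
    have hi := hlt i
    have hj := hlt j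
    have h1 := hprod i j hij
    have h2 := hprod i l hil
    have h3 := hprod j l hjl
    have hsq : (1 + Q3 (x (i, true)) (x (i, false))) ^ 2 * 4 = 4 * 4 := by
      linear_combination h1 * (1 + Q3 (x (i, true)) (x (i, false))) *
        (1 + Q3 (x (l, true)) (x (l, false))) + 4 * h2 -
        (1 + Q3 (x (i, true)) (x (i, false))) ^ 2 * h3
    nlinarith
  have hall (i : Fin 4) : Q3 (x (i, true)) (x (i, false)) = -3 :=
    hval i (i + 1) (i + 2) (by decide +revert) (by decide +revert) (by decide +revert)
  rintro ⟨i, _ | _⟩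
  · exact (hflip i).trans (hall i)
  · exact hall i
end
end

section
/- Integrality criterion for cubical Apollonian disk packings. Let y be a cubical disk packing and let u, v, w ∈ {0,1}³ with h(u,v) = h(v,w) = 1 and h(u,w) = 2; set a := κ(y_u), b := κ(y_v), c := κ(y_w) (the curvatures of three consecutive tangent disks of the packing). Then the cubical Apollonian packing Ω(y) is integral if and only if a, b, c are integers and there exists an integer n with n² = ab + bc + ca − b². -/
noncomputable section

/-- Inversive product on ℝ⁴. -/
def Q2 (a b : Fin 4 → ℝ) : ℝ := a 0 * b 0 + a 1 * b 1 + a 2 * b 2 - a 3 * b 3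

/-- Curvature of a disk in inversive coordinates. -/
def curv2 (a : Fin 4 → ℝ) : ℝ := a 3 - a 2

/-- A cubical disk packing, indexed by the vertices of the cube `{0,1}³`
(here `Fin 3 → Bool`), with inversive products prescribed by Hamming distance. -/
def IsCubicalPacking (y : (Fin 3 → Bool) → (Fin 4 → ℝ)) : Prop :=
  ∀ u v, Q2 (y u) (y v) = 1 - 2 * (hammingDist u v : ℝ)

/-- Generators of the cubical Apollonian group. -/
def cubicalGens (y : (Fin 3 → Bool) → (Fin 4 → ℝ)) : Set ((Fin 4 → ℝ) ≃ₗ[ℝ] (Fin 4 → ℝ)) :=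
  {g | ∃ w : Fin 4 → ℝ, Q2 w w = 1 ∧
        (∃ i : Fin 3, ∃ c : Bool, ∀ u, u i = c → Q2 w (y u) = 0) ∧
        ∀ z, g z = z - (2 * Q2 z w) • w}

/-- The cubical Apollonian packing. -/
def cubicalOmega (y : (Fin 3 → Bool) → (Fin 4 → ℝ)) : Set (Fin 4 → ℝ) :=
  {b | ∃ g ∈ Subgroup.closure (cubicalGens y), ∃ u, b = g (y u)}

lemma Q2_comm (a b : Fin 4 → ℝ) : Q2 a b = Q2 b a := by
  simp only [Q2]; ring

lemma Q2_add_right (a b c : Fin 4 → ℝ) : Q2 a (b + c) = Q2 a b + Q2 a c := by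
  simp only [Q2, Pi.add_apply]; ring

lemma Q2_sub_right (a b c : Fin 4 → ℝ) : Q2 a (b - c) = Q2 a b - Q2 a c := by
  simp only [Q2, Pi.sub_apply]; ring

lemma Q2_smul_right (r : ℝ) (a b : Fin 4 → ℝ) : Q2 a (r • b) = r * Q2 a b := by
  simp only [Q2, Pi.smul_apply, smul_eq_mul]; ring

lemma Q2_add_left (a b c : Fin 4 → ℝ) : Q2 (a + b) c = Q2 a c + Q2 b c := by
  simp only [Q2, Pi.add_apply]; ring

lemma Q2_sub_left (a b c : Fin 4 → ℝ) : Q2 (a - b) c = Q2 a c - Q2 b c := by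
  simp only [Q2, Pi.sub_apply]; ring

lemma Q2_smul_left (r : ℝ) (a b : Fin 4 → ℝ) : Q2 (r • a) b = r * Q2 a b := by
  simp only [Q2, Pi.smul_apply, smul_eq_mul]; ring

lemma Q2_sum_right (a : Fin 4 → ℝ) (f : Fin 3 → Fin 4 → ℝ) :
    Q2 a (∑ i, f i) = ∑ i, Q2 a (f i) := by
  simp only [Fin.sum_univ_three, Q2_add_right]

lemma Q2_sum_left (f : Fin 3 → Fin 4 → ℝ) (a : Fin 4 → ℝ) :
    Q2 (∑ i, f i) a = ∑ i, Q2 (f i) a := by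
  simp only [Fin.sum_univ_three, Q2_add_left]

lemma curv2_eq_Q2 (z : Fin 4 → ℝ) : curv2 z = Q2 z ![0, 0, -1, -1] := by
  simp [curv2, Q2]; ring

/-- The sign `±1` attached to a bit. -/
def bitSign (b : Bool) : ℤ := if b then 1 else -1

lemma bitSign_sq (b : Bool) : (bitSign b : ℝ) ^ 2 = 1 := by
  cases b <;> simp [bitSign]

lemma bitSign_not (b : Bool) : bitSign (!b) = -bitSign b := by
  cases b <;> simp [bitSign]

/-- `e` and `p` form a `Q2`-orthogonal frame with norms `1, 1, 1, -2`. -/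
structure IsCubeFrame (e : Fin 3 → Fin 4 → ℝ) (p : Fin 4 → ℝ) : Prop where
  e_e : ∀ i j, Q2 (e i) (e j) = if i = j then 1 else 0
  p_e : ∀ i, Q2 p (e i) = 0
  p_p : Q2 p p = -2

namespace IsCubeFrame

variable {e : Fin 3 → Fin 4 → ℝ} {p : Fin 4 → ℝ}

lemma e_p (h : IsCubeFrame e p) (i : Fin 3) : Q2 (e i) p = 0 := by
  rw [Q2_comm, h.p_e]

lemma expansion (h : IsCubeFrame e p) (z : Fin 4 → ℝ) :
    z = ∑ i, Q2 z (e i) • e i - (Q2 z p / 2) • p := by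
  let M : Matrix (Fin 4) (Fin 4) ℝ := ![e 0, e 1, e 2, p]
  let g : Fin 4 → ℝ := ![1, 1, 1, -1]
  let d : Fin 4 → ℝ := ![1, 1, 1, -1 / 2]
  let N : Matrix (Fin 4) (Fin 4) ℝ := Matrix.of fun x j => g x * M j x * d j
  have key : ∀ i j, (M * N) i j = Q2 (M i) (M j) * d j := by
    intro i j
    simp only [Matrix.mul_apply, Fin.sum_univ_four, N, Matrix.of_apply, g, Q2]
    simp
    ring
  have hMN : M * N = 1 := by
    ext i j
    rw [key]
    fin_cases i <;> fin_cases j <;> simp [M, d, h.e_e, h.p_e, h.e_p, h.p_p]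
    norm_num
  have hNM : N * M = 1 := mul_eq_one_comm.mp hMN
  have hz : Matrix.vecMul (Matrix.vecMul z N) M = z := by
    rw [Matrix.vecMul_vecMul, hNM, Matrix.vecMul_one]
  conv_lhs => rw [← hz]
  funext y
  simp [Matrix.vecMul, dotProduct, Fin.sum_univ_four, Fin.sum_univ_three, N, M, g, d, Q2]
  ring

lemma curv2_sq (h : IsCubeFrame e p) : curv2 p ^ 2 = 2 * ∑ i, curv2 (e i) ^ 2 := by
  set k : Fin 4 → ℝ := ![0, 0, -1, -1]
  have hk : Q2 k k = 0 := by simp [k, Q2]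
  have hx := congrArg (fun t => Q2 t k) (h.expansion k)
  simp only [hk, Q2_sub_left, Q2_sum_left, Q2_smul_left] at hx
  simp only [curv2_eq_Q2, Fin.sum_univ_three] at hx ⊢
  simp only [Q2_comm k] at hx
  linarith

end IsCubeFrame

namespace IsCubicalPacking

variable {y : (Fin 3 → Bool) → (Fin 4 → ℝ)}

lemma exists_frame (hy : IsCubicalPacking y) :
    ∃ e p, IsCubeFrame e p ∧ ∀ u, y u = p + ∑ i, (bitSign (u i) : ℝ) • e i := by
  let o : Fin 3 → Bool := fun _ => false
  let t : Fin 3 → Fin 3 → Bool := fun i j => decide (j = i)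
  let e : Fin 3 → Fin 4 → ℝ := fun i => (1 / 2 : ℝ) • (y (t i) - y o)
  let p : Fin 4 → ℝ := y o + ∑ i, e i
  have hdist : ∀ (u : Fin 3 → Bool) (i : Fin 3),
      (hammingDist u o : ℤ) - hammingDist u (t i) = bitSign (u i) := by decide
  have hye : ∀ u i, Q2 (y u) (e i) = bitSign (u i) := by
    intro u i
    simp only [e, Q2_smul_right, Q2_sub_right, hy u, ← hdist]
    push_cast
    ring
  have hsum : ∀ u : Fin 3 → Bool,
      -2 * (hammingDist u o : ℤ) + ∑ i, bitSign (u i) = -3 := by decide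
  have hyp : ∀ u, Q2 (y u) p = -2 := by
    intro u
    have hs : -2 * (hammingDist u o : ℝ) + ∑ i, (bitSign (u i) : ℝ) = -3 := by
      exact_mod_cast hsum u
    simp only [p, Q2_add_right, Q2_sum_right, hye, hy u]
    linarith
  have hframe : IsCubeFrame e p := by
    have he : ∀ i j, Q2 (e i) (e j) = if i = j then 1 else 0 := by
      intro i j
      have : Q2 (e i) (e j) = 1 / 2 * (bitSign (t i j) - bitSign (o j)) := by
        rw [show e i = (1 / 2 : ℝ) • (y (t i) - y o) from rfl, Q2_smul_left, Q2_sub_left,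
          hye, hye]
      rw [this]
      fin_cases i <;> fin_cases j <;> norm_num [t, o, bitSign]
    have hp : ∀ i, Q2 p (e i) = 0 := by
      intro i
      simp only [p, Q2_add_left, Q2_sum_left, hye, he]
      simp [o, bitSign]
    refine ⟨he, hp, ?_⟩
    rw [show Q2 p p = Q2 p (y o) + ∑ i, Q2 p (e i) by
      simp only [p, Q2_add_right, Q2_sum_right], Q2_comm, hyp]
    simp [hp]
  refine ⟨e, p, hframe, fun u => ?_⟩
  conv_lhs => rw [hframe.expansion (y u)]
  simp only [hye, hyp]
  module

end IsCubicalPacking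

/-- A unit vector orthogonal to a face of the packing defines the reflection along
`p ± 2 eᵢ`. -/
lemma IsCubeFrame.reflection_eq {y : (Fin 3 → Bool) → (Fin 4 → ℝ)}
    {e : Fin 3 → Fin 4 → ℝ} {p : Fin 4 → ℝ} (h : IsCubeFrame e p)
    (hy : ∀ u, y u = p + ∑ i, (bitSign (u i) : ℝ) • e i)
    {w : Fin 4 → ℝ} (hw : Q2 w w = 1) {i : Fin 3} {c : Bool}
    (hface : ∀ u, u i = c → Q2 w (y u) = 0) (z : Fin 4 → ℝ) :
    (2 * Q2 z w) • w =
      Q2 z (p + (2 * bitSign c : ℝ) • e i) • (p + (2 * bitSign c : ℝ) • e i) := by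
  have hs := bitSign_sq c
  have hface' : ∀ u : Fin 3 → Bool, u i = c →
      Q2 w p + ∑ j, (bitSign (u j) : ℝ) * Q2 w (e j) = 0 := by
    intro u hu
    simpa only [hy, Q2_add_right, Q2_sum_right, Q2_smul_right] using hface u hu
  have hsplit : ∀ (u : Fin 3 → Bool) (j : Fin 3) (b : Bool) (x : Fin 3 → ℝ),
      ∑ l, (bitSign (Function.update u j b l) : ℝ) * x l =
        ∑ l, (bitSign (u l) : ℝ) * x l + (bitSign b - bitSign (u j)) * x j := by
    intro u j b x
    fin_cases j <;> simp [Fin.sum_univ_three, Function.update] <;> ring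
  have hzero : ∀ j, j ≠ i → Q2 w (e j) = 0 := by
    intro j hj
    have h1 := hface' (fun _ => c) rfl
    have h2 := hface' (Function.update (fun _ => c) j (!c)) (by simp [hj.symm])
    rw [hsplit, bitSign_not] at h2
    push_cast at h2
    linear_combination (-bitSign c / 2 : ℝ) * (h2 - h1) - Q2 w (e j) * hs
  have hi : Q2 w (e i) = -bitSign c * Q2 w p := by
    have h1 := hface' (fun _ => c) rfl
    rw [Finset.sum_eq_single i (fun j _ hj => by rw [hzero j hj, mul_zero]) (by simp)] at h1
    linear_combination (bitSign c : ℝ) * h1 - Q2 w (e i) * hs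
  have hwf : w = (-(Q2 w p) / 2) • (p + (2 * bitSign c : ℝ) • e i) := by
    conv_lhs => rw [h.expansion w]
    rw [Finset.sum_eq_single i (fun j _ hj => by rw [hzero j hj, zero_smul]) (by simp), hi]
    module
  set f := p + (2 * bitSign c : ℝ) • e i with hf
  have hff : Q2 f f = 2 := by
    simp only [hf, Q2_add_left, Q2_add_right, Q2_smul_left, Q2_smul_right, h.p_p, h.p_e, h.e_p,
      h.e_e, if_true]
    linear_combination 4 * hs
  set q := Q2 w p
  have hq : q ^ 2 = 2 := by
    rw [hwf, Q2_smul_left, Q2_smul_right, hff] at hw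
    linear_combination 2 * hw
  rw [hwf, Q2_smul_right, smul_smul]
  congr 1
  linear_combination Q2 z f / 2 * hq

/-- The lattice spanned by `p` and the vectors `p ± e₀ ± e₁ ± e₂`. -/
def cubeLattice (e : Fin 3 → Fin 4 → ℝ) (p : Fin 4 → ℝ) : Set (Fin 4 → ℝ) :=
  {z | ∃ (n m : ℤ) (k : Fin 3 → ℤ), z = (n : ℝ) • p + ∑ i, ((m : ℝ) + 2 * k i) • e i}

lemma mem_cubeLattice_of_eq {y : (Fin 3 → Bool) → (Fin 4 → ℝ)}
    {e : Fin 3 → Fin 4 → ℝ} {p : Fin 4 → ℝ}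
    (hy : ∀ u, y u = p + ∑ i, (bitSign (u i) : ℝ) • e i) (u : Fin 3 → Bool) :
    y u ∈ cubeLattice e p := by
  refine ⟨1, 1, fun i => if u i then 0 else -1, ?_⟩
  rw [hy, Int.cast_one, one_smul]
  congr 1
  refine Finset.sum_congr rfl fun i _ => ?_
  cases hui : u i <;> norm_num [bitSign, hui]

lemma IsCubeFrame.reflection_mem {e : Fin 3 → Fin 4 → ℝ} {p : Fin 4 → ℝ}
    (h : IsCubeFrame e p) (i : Fin 3) (s : ℤ) {z : Fin 4 → ℝ} (hz : z ∈ cubeLattice e p) :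
    z - Q2 z (p + (2 * s : ℝ) • e i) • (p + (2 * s : ℝ) • e i) ∈ cubeLattice e p := by
  obtain ⟨n, m, k, rfl⟩ := hz
  set z := (n : ℝ) • p + ∑ i, ((m : ℝ) + 2 * k i) • e i with hz
  have hQ : Q2 z (p + (2 * s : ℝ) • e i) = ((-2 * n + 2 * s * (m + 2 * k i) : ℤ) : ℝ) := by
    simp only [hz, Q2_add_left, Q2_add_right, Q2_smul_left, Q2_smul_right, Q2_sum_left, h.p_p,
      h.p_e, h.e_p, h.e_e]
    simp
    ring
  rw [hQ]
  set t : ℤ := -2 * n + 2 * s * (m + 2 * k i)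
  refine ⟨n - t, m, fun j => k j - if j = i then t * s else 0, ?_⟩
  have hsum : ∑ j, ((m : ℝ) + 2 * ((k j - if j = i then t * s else 0 : ℤ) : ℝ)) • e j =
      ∑ j, ((m : ℝ) + 2 * k j) • e j - (2 * t * s : ℝ) • e i := by
    have hterm : ∀ j, ((m : ℝ) + 2 * ((k j - if j = i then t * s else 0 : ℤ) : ℝ)) • e j =
        ((m : ℝ) + 2 * k j) • e j - if j = i then (2 * t * s : ℝ) • e j else 0 := by
      intro j
      split_ifs <;> push_cast <;> module
    simp only [hterm, Finset.sum_sub_distrib, Finset.sum_ite_eq', Finset.mem_univ, if_true]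
  rw [hsum, hz]
  push_cast
  module

lemma IsCubeFrame.cubicalOmega_subset {y : (Fin 3 → Bool) → (Fin 4 → ℝ)}
    {e : Fin 3 → Fin 4 → ℝ} {p : Fin 4 → ℝ} (h : IsCubeFrame e p)
    (hy : ∀ u, y u = p + ∑ i, (bitSign (u i) : ℝ) • e i) :
    cubicalOmega y ⊆ cubeLattice e p := by
  have hgen : ∀ g ∈ cubicalGens y, ∀ z ∈ cubeLattice e p, g z ∈ cubeLattice e p := by
    rintro g ⟨w, hw, ⟨i, c, hface⟩, hg⟩ z hz
    rw [hg, h.reflection_eq hy hw hface]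
    exact h.reflection_mem i (bitSign c) hz
  have hinv : ∀ g ∈ cubicalGens y, g⁻¹ = g := by
    rintro g ⟨w, hw, -, hg⟩
    refine inv_eq_of_mul_eq_one_left (LinearEquiv.ext fun z => ?_)
    change g (g z) = z
    rw [hg (g z), hg z, Q2_sub_left, Q2_smul_left, hw]
    module
  have hgroup : ∀ g ∈ Subgroup.closure (cubicalGens y),
      ∀ z ∈ cubeLattice e p, g z ∈ cubeLattice e p := by
    intro g hg
    induction hg using Subgroup.closure_induction'' with
    | one => exact fun z hz => hz
    | mem x hx => exact hgen x hx
    | inv_mem x hx => rw [hinv x hx]; exact hgen x hx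
    | mul x z _ _ hx hz => exact fun t ht => hx _ (hz _ ht)
  rintro _ ⟨g, hg, u, rfl⟩
  exact hgroup g hg _ (mem_cubeLattice_of_eq hy u)

lemma mem_cubicalOmega (y : (Fin 3 → Bool) → (Fin 4 → ℝ)) (u : Fin 3 → Bool) :
    y u ∈ cubicalOmega y :=
  ⟨1, one_mem _, u, rfl⟩

lemma exists_flip_of_hammingDist_eq_one : ∀ u v : Fin 3 → Bool, hammingDist u v = 1 →
    ∃ i, u i = !v i ∧ ∀ j, j ≠ i → u j = v j := by
  decide

lemma exists_int_of_two_mul_of_sq {x : ℝ} {m d : ℤ} (hm : 2 * x = m) (hd : x ^ 2 = d) :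
    ∃ n : ℤ, x = n := by
  have hmd : m ^ 2 = 4 * d := by
    have : (m : ℝ) ^ 2 = 4 * d := by rw [← hm, ← hd]; ring
    exact_mod_cast this
  have heven : Even m := (Int.even_pow.mp ⟨2 * d, by rw [hmd]; ring⟩).1
  obtain ⟨n, rfl⟩ := heven
  refine ⟨n, ?_⟩
  push_cast at hm
  linarith

/-- Integrality criterion for cubical Apollonian disk packings: the packing is integral iff
the curvatures a, b, c of three consecutive tangent disks are integers and `ab+bc+ca−b²` is a
perfect square. -/
theorem cubical_integrality (y : (Fin 3 → Bool) → (Fin 4 → ℝ)) (hy : IsCubicalPacking y)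
    (u v w : Fin 3 → Bool) (huv : hammingDist u v = 1) (hvw : hammingDist v w = 1)
    (huw : hammingDist u w = 2)
    (a b c : ℝ) (ha : a = curv2 (y u)) (hb : b = curv2 (y v)) (hc : c = curv2 (y w)) :
    (∀ z ∈ cubicalOmega y, ∃ n : ℤ, curv2 z = n) ↔
      ((∃ m : ℤ, a = m) ∧ (∃ m : ℤ, b = m) ∧ (∃ m : ℤ, c = m) ∧
        ∃ n : ℤ, (n : ℝ) ^ 2 = a * b + b * c + c * a - b ^ 2) := by
  obtain ⟨e, p, h, hye⟩ := hy.exists_frame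
  have hκ : ∀ u, curv2 (y u) = curv2 p + ∑ i, (bitSign (u i) : ℝ) * curv2 (e i) := by
    intro u
    simp only [curv2_eq_Q2, hye, Q2_add_left, Q2_sum_left, Q2_smul_left]
  obtain ⟨i, hui, hu⟩ := exists_flip_of_hammingDist_eq_one u v huv
  obtain ⟨j, hwj, hw⟩ := exists_flip_of_hammingDist_eq_one w v (by rwa [hammingDist_comm])
  have hij : i ≠ j := by
    rintro rfl
    have : u = w := by
      funext l
      by_cases hl : l = i
      · rw [hl, hui, hwj]
      · rw [hu l hl, hw l hl]
    simp [this] at huw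
  obtain ⟨k, hki, hkj, hall, hsum⟩ : ∃ k, k ≠ i ∧ k ≠ j ∧
      (∀ l, l = i ∨ l = j ∨ l = k) ∧ ∀ x : Fin 3 → ℝ, ∑ l, x l = x i + x j + x k := by
    have hk : ∀ i j : Fin 3, i ≠ j → ∃ k, k ≠ i ∧ k ≠ j ∧ Finset.univ = {i, j, k} := by decide
    obtain ⟨k, hki, hkj, huniv⟩ := hk i j hij
    refine ⟨k, hki, hkj, fun l => by simpa [huniv] using Finset.mem_univ l, fun x => ?_⟩
    rw [huniv, Finset.sum_insert (by simp [hij, hki.symm]), Finset.sum_pair hkj.symm, add_assoc]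
  have hnull := h.curv2_sq
  rw [hsum] at hnull
  have ha' := ha
  have hb' := hb
  have hc' := hc
  rw [hκ, hsum] at ha hb hc
  rw [hui, hu j hij.symm, hu k hki, bitSign_not] at ha
  rw [hwj, hw i hij, hw k hkj, bitSign_not] at hc
  push_cast at ha hc
  have hi := bitSign_sq (v i)
  have hj := bitSign_sq (v j)
  have hk := bitSign_sq (v k)
  set P := curv2 p
  have hdisc : (P - (a + c)) ^ 2 = a * b + b * c + c * a - b ^ 2 := by
    rw [ha, hb, hc]
    linear_combination -hnull + 2 * curv2 (e i) ^ 2 * hi + 2 * curv2 (e j) ^ 2 * hj +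
      2 * curv2 (e k) ^ 2 * hk
  constructor
  · intro hint
    obtain ⟨A, hA⟩ := hint _ (mem_cubicalOmega y u)
    obtain ⟨B, hB⟩ := hint _ (mem_cubicalOmega y v)
    obtain ⟨C, hC⟩ := hint _ (mem_cubicalOmega y w)
    obtain ⟨D, hD⟩ := hint _ (mem_cubicalOmega y fun l => !v l)
    rw [← ha'] at hA
    rw [← hb'] at hB
    rw [← hc'] at hC
    simp only [hκ, hsum, bitSign_not] at hD
    push_cast at hD
    obtain ⟨n, hn⟩ := exists_int_of_two_mul_of_sq (x := P - (a + c))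
      (m := D + B - 2 * A - 2 * C) (d := A * B + B * C + C * A - B ^ 2)
      (by push_cast; rw [← hA, ← hC, ← hB, ← hD, hb]; ring)
      (by push_cast; rw [← hA, ← hC, ← hB, hdisc])
    exact ⟨⟨A, hA⟩, ⟨B, hB⟩, ⟨C, hC⟩, n, by rw [← hn, hdisc]⟩
  · rintro ⟨⟨A, hA⟩, ⟨B, hB⟩, ⟨C, hC⟩, n, hn⟩ z hz
    obtain ⟨P', hP⟩ : ∃ P' : ℤ, P = P' := by
      rcases sq_eq_sq_iff_eq_or_eq_neg.mp (hdisc.trans hn.symm) with h1 | h1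
      · exact ⟨A + C + n, by push_cast; linarith⟩
      · exact ⟨A + C - n, by push_cast; linarith⟩
    have hσ : ∀ l, ∃ q : ℤ, 2 * ((bitSign (v l) : ℝ) * curv2 (e l)) = q := by
      intro l
      rcases hall l with rfl | rfl | rfl
      · exact ⟨B - A, by push_cast; linarith⟩
      · exact ⟨B - C, by push_cast; linarith⟩
      · exact ⟨A + C - 2 * P', by push_cast; linarith⟩
    have htwo : ∀ l, ∃ q : ℤ, 2 * curv2 (e l) = q := by
      intro l
      obtain ⟨q, hq⟩ := hσ l
      refine ⟨bitSign (v l) * q, ?_⟩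
      push_cast
      rw [← hq]
      linear_combination -2 * curv2 (e l) * bitSign_sq (v l)
    have hdiff : ∀ l, ∃ r : ℤ, curv2 (e l) = bitSign (v l) * curv2 (e l) + r := by
      intro l
      obtain ⟨q, hq⟩ := htwo l
      cases v l
      · exact ⟨q, by simp only [bitSign]; push_cast; linarith⟩
      · exact ⟨0, by simp [bitSign]⟩
    choose q hq using htwo
    choose r hr using hdiff
    have hS : ∑ l, curv2 (e l) = ((B - P' + (r i + r j + r k) : ℤ) : ℝ) := by
      rw [hsum]
      push_cast
      linarith [hr i, hr j, hr k]
    obtain ⟨n', m, t, rfl⟩ := h.cubicalOmega_subset hye hz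
    refine ⟨n' * P' + m * (B - P' + (r i + r j + r k)) + ∑ l, t l * q l, ?_⟩
    have hκz : curv2 ((n' : ℝ) • p + ∑ l, ((m : ℝ) + 2 * t l) • e l) =
        n' * P + m * ∑ l, curv2 (e l) + ∑ l, (t l : ℝ) * (2 * curv2 (e l)) := by
      simp only [P, curv2_eq_Q2, Q2_add_left, Q2_smul_left, Fin.sum_univ_three]
      ring
    rw [hκz, hS, hP]
    simp only [hq]
    push_cast
    ring
end
end
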